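/- arXiv:1501.06185 — 4 statements merged into one kernel-verified Lean document; each statement's English description precedes it below -/
import Mathlib

section
/- Let ℚⁿ = U ⊕ V be an internal direct sum of ℚ-subspaces, and let ψ_U : ℚ^d → U and ψ_V : ℚ^e → V be ℚ-linear isomorphisms. Then there exist constants M ≥ 1 and C ≥ 0 such that for all u ∈ U and v ∈ V: ln(μ_E(u+v)+1) ≤ M·(ln(μ_E(ψ_U⁻¹(u))+1) + ln(μ_E(ψ_V⁻¹(v))+1)) + C, and ln(μ_E(ψ_U⁻¹(u))+1) + ln(μ_E(ψ_V⁻¹(v))+1) ≤ M·ln(μ_E(u+v)+1) + C. -/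
/-- For a rational number `β = γ/α` in lowest terms, `μ(β) = |γ|·α`. -/
noncomputable def mu (q : ℚ) : ℝ := (q.num.natAbs * q.den : ℕ)

/-- `μ_E` of a vector of `ℚᵐ`, coordinates in the standard basis. -/
noncomputable def muE {m : ℕ} (b : Fin m → ℚ) : ℝ := ∑ i, mu (b i)

/-- The logarithmic size `log (|num| + den)` of a rational number, subadditive for both
addition and multiplication. -/
noncomputable def logSize (q : ℚ) : ℝ := Real.log ((q.num.natAbs : ℝ) + q.den)

/-- The total logarithmic size of a rational vector. -/
noncomputable def logSizeSum {m : ℕ} (b : Fin m → ℚ) : ℝ := ∑ i, logSize (b i)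

lemma one_le_natAbs_num_add_den (q : ℚ) : (1 : ℝ) ≤ (q.num.natAbs : ℝ) + q.den := by
  have h := q.pos
  exact_mod_cast (by omega : 1 ≤ q.num.natAbs + q.den)

lemma logSize_nonneg (q : ℚ) : 0 ≤ logSize q :=
  Real.log_nonneg (one_le_natAbs_num_add_den q)

lemma logSize_zero : logSize 0 = 0 := by simp [logSize]

/-- A representation of a rational number as a fraction bounds its logarithmic size. -/
lemma logSize_le_of_mul_eq {q : ℚ} {a : ℤ} {b : ℕ} (hb : b ≠ 0) (h : q * b = a) :
    logSize q ≤ Real.log ((a.natAbs : ℝ) + b) := by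
  have hb' : (b : ℚ) ≠ 0 := by exact_mod_cast hb
  have hq : q = (a : ℚ) / (b : ℤ) := by
    rw [eq_div_iff (by exact_mod_cast hb')]
    exact_mod_cast h
  have hbz : (b : ℤ) ≠ 0 := by exact_mod_cast hb
  obtain ⟨c, hc1, hc2⟩ := Rat.num_den_mk hbz (hq.trans (Rat.divInt_eq_div a b).symm)
  have hc : 1 ≤ c.natAbs := by
    rcases Nat.eq_zero_or_pos c.natAbs with h0 | h0
    · rw [Int.natAbs_eq_zero.mp h0, zero_mul] at hc2
      exact absurd hc2 hbz
    · exact h0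
  have h1 : q.num.natAbs ≤ a.natAbs := by
    rw [hc1, Int.natAbs_mul]
    exact Nat.le_mul_of_pos_left _ hc
  have h2 : q.den ≤ b := by
    have := congrArg Int.natAbs hc2
    rw [Int.natAbs_mul, Int.natAbs_natCast, Int.natAbs_natCast] at this
    rw [this]
    exact Nat.le_mul_of_pos_left _ hc
  refine Real.log_le_log (by linarith [one_le_natAbs_num_add_den q]) ?_
  exact_mod_cast Nat.add_le_add h1 h2

lemma logSize_add_logSize (q r : ℚ) : logSize q + logSize r =
    Real.log (((q.num.natAbs : ℝ) + q.den) * ((r.num.natAbs : ℝ) + r.den)) := by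
  rw [Real.log_mul (by linarith [one_le_natAbs_num_add_den q])
    (by linarith [one_le_natAbs_num_add_den r])]
  rfl

lemma logSize_add_le (q r : ℚ) : logSize (q + r) ≤ logSize q + logSize r := by
  have h := logSize_le_of_mul_eq (q := q + r) (a := q.num * r.den + r.num * q.den)
    (b := q.den * r.den) (mul_ne_zero q.den_ne_zero r.den_ne_zero) (by
      push_cast
      linear_combination (r.den : ℚ) * q.mul_den_eq_num + (q.den : ℚ) * r.mul_den_eq_num)
  refine h.trans ?_
  rw [logSize_add_logSize]
  have hd : 0 < q.den * r.den := Nat.mul_pos q.pos r.pos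
  refine Real.log_le_log (by positivity) ?_
  have h1 := Int.natAbs_add_le (q.num * r.den) (r.num * q.den)
  rw [Int.natAbs_mul, Int.natAbs_mul, Int.natAbs_natCast, Int.natAbs_natCast] at h1
  have h2 : (q.num * r.den + r.num * q.den).natAbs + q.den * r.den ≤
      (q.num.natAbs + q.den) * (r.num.natAbs + r.den) := by
    linarith [Nat.zero_le (q.num.natAbs * r.num.natAbs)]
  exact_mod_cast h2

lemma logSize_mul_le (q r : ℚ) : logSize (q * r) ≤ logSize q + logSize r := by
  have h := logSize_le_of_mul_eq (q := q * r) (a := q.num * r.num)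
    (b := q.den * r.den) (mul_ne_zero q.den_ne_zero r.den_ne_zero) (by
      push_cast
      rw [← q.mul_den_eq_num, ← r.mul_den_eq_num]
      ring)
  refine h.trans ?_
  rw [logSize_add_logSize]
  have hd : 0 < q.den * r.den := Nat.mul_pos q.pos r.pos
  refine Real.log_le_log (by positivity) ?_
  have h2 : (q.num * r.num).natAbs + q.den * r.den ≤
      (q.num.natAbs + q.den) * (r.num.natAbs + r.den) := by
    rw [Int.natAbs_mul]
    linarith [Nat.zero_le (q.num.natAbs * r.den), Nat.zero_le (q.den * r.num.natAbs)]
  exact_mod_cast h2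

lemma logSize_sum_le {ι : Type*} (s : Finset ι) (f : ι → ℚ) :
    logSize (∑ i ∈ s, f i) ≤ ∑ i ∈ s, logSize (f i) :=
  Finset.le_sum_of_subadditive logSize logSize_zero.le logSize_add_le s f

lemma sum_add_one_le_prod_add_one {ι : Type*} (s : Finset ι) {f : ι → ℝ}
    (hf : ∀ i ∈ s, 0 ≤ f i) : ∑ i ∈ s, f i + 1 ≤ ∏ i ∈ s, (f i + 1) := by
  classical
  induction s using Finset.induction_on with
  | empty => simp
  | insert a s ha ih =>
    rw [Finset.sum_insert ha, Finset.prod_insert ha]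
    have h0 := hf a (Finset.mem_insert_self a s)
    have hs := Finset.sum_nonneg fun i hi => hf i (Finset.mem_insert_of_mem hi)
    nlinarith [ih fun i hi => hf i (Finset.mem_insert_of_mem hi), mul_nonneg h0 hs]

lemma mu_nonneg (q : ℚ) : 0 ≤ mu q := Nat.cast_nonneg _

lemma muE_nonneg {m : ℕ} (b : Fin m → ℚ) : 0 ≤ muE b :=
  Finset.sum_nonneg fun i _ => mu_nonneg (b i)

lemma log_muE_add_one_nonneg {m : ℕ} (b : Fin m → ℚ) : 0 ≤ Real.log (muE b + 1) :=
  Real.log_nonneg (by linarith [muE_nonneg b])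

lemma logSize_le_log_mu_add_one (q : ℚ) : logSize q ≤ Real.log (mu q + 1) := by
  refine Real.log_le_log (by linarith [one_le_natAbs_num_add_den q]) ?_
  have h : q.num.natAbs + q.den ≤ q.num.natAbs * q.den + 1 := by
    rcases eq_or_ne q 0 with rfl | hq
    · simp
    · have h1 := Int.natAbs_pos.mpr (Rat.num_ne_zero.mpr hq)
      have h2 := q.pos
      nlinarith
  unfold mu
  exact_mod_cast h

lemma log_mu_add_one_le (q : ℚ) : Real.log (mu q + 1) ≤ 2 * logSize q := by
  rw [two_mul, logSize_add_logSize]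
  refine Real.log_le_log (by linarith [mu_nonneg q]) ?_
  have h : q.num.natAbs * q.den + 1 ≤
      (q.num.natAbs + q.den) * (q.num.natAbs + q.den) := by
    nlinarith [Nat.pow_pos (n := 2) q.pos, Nat.zero_le (q.num.natAbs ^ 2),
      Nat.zero_le (q.num.natAbs * q.den)]
  unfold mu
  exact_mod_cast h

lemma logSizeSum_nonneg {m : ℕ} (b : Fin m → ℚ) : 0 ≤ logSizeSum b :=
  Finset.sum_nonneg fun i _ => logSize_nonneg (b i)

lemma logSizeSum_le {m : ℕ} (b : Fin m → ℚ) :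
    logSizeSum b ≤ m * Real.log (muE b + 1) := by
  have h : ∀ i ∈ Finset.univ, logSize (b i) ≤ Real.log (muE b + 1) := fun i hi => by
    refine (logSize_le_log_mu_add_one _).trans
      (Real.log_le_log (by linarith [mu_nonneg (b i)]) ?_)
    have := Finset.single_le_sum (fun j _ => mu_nonneg (b j)) hi
    exact add_le_add_left this 1
  simpa [logSizeSum] using Finset.sum_le_card_nsmul _ _ _ h

lemma log_muE_add_one_le {m : ℕ} (b : Fin m → ℚ) :
    Real.log (muE b + 1) ≤ 2 * logSizeSum b := by
  have hp : muE b + 1 ≤ ∏ i, (mu (b i) + 1) :=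
    sum_add_one_le_prod_add_one _ fun i _ => mu_nonneg (b i)
  calc Real.log (muE b + 1) ≤ Real.log (∏ i, (mu (b i) + 1)) :=
        Real.log_le_log (by linarith [muE_nonneg b]) hp
    _ = ∑ i, Real.log (mu (b i) + 1) :=
        Real.log_prod fun i _ => by linarith [mu_nonneg (b i)]
    _ ≤ ∑ i, 2 * logSize (b i) := Finset.sum_le_sum fun i _ => log_mu_add_one_le (b i)
    _ = 2 * logSizeSum b := by rw [← Finset.mul_sum]; rfl

lemma logSizeSum_add_le {m : ℕ} (b c : Fin m → ℚ) :
    logSizeSum (b + c) ≤ logSizeSum b + logSizeSum c := by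
  unfold logSizeSum
  rw [← Finset.sum_add_distrib]
  exact Finset.sum_le_sum fun i _ => logSize_add_le (b i) (c i)

lemma exists_logSizeSum_map_le {m k : ℕ} (T : (Fin m → ℚ) →ₗ[ℚ] (Fin k → ℚ)) :
    ∃ C : ℝ, 0 ≤ C ∧ ∀ b, logSizeSum (T b) ≤ k * logSizeSum b + C := by
  refine ⟨∑ i, ∑ j, logSize (T (Pi.single j 1) i),
    Finset.sum_nonneg fun i _ => Finset.sum_nonneg fun j _ => logSize_nonneg _, fun b => ?_⟩
  have h : ∀ i, logSize (T b i) ≤ logSizeSum b + ∑ j, logSize (T (Pi.single j 1) i) := by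
    intro i
    have hT : T b i = ∑ j, b j * T (Pi.single j 1) i := by
      conv_lhs => rw [pi_eq_sum_univ' b]
      simp [Finset.sum_apply]
    rw [hT, logSizeSum, ← Finset.sum_add_distrib]
    exact (logSize_sum_le _ _).trans (Finset.sum_le_sum fun j _ => logSize_mul_le _ _)
  calc logSizeSum (T b) ≤ ∑ i, (logSizeSum b + ∑ j, logSize (T (Pi.single j 1) i)) :=
        Finset.sum_le_sum fun i _ => h i
    _ = _ := by simp [Finset.sum_add_distrib]

/-- Linear maps change `log (μ_E + 1)` in an at most affine way. -/
lemma exists_log_muE_map_le {m k : ℕ} (T : (Fin m → ℚ) →ₗ[ℚ] (Fin k → ℚ)) :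
    ∃ M C : ℝ, 0 ≤ M ∧ 0 ≤ C ∧
      ∀ b, Real.log (muE (T b) + 1) ≤ M * Real.log (muE b + 1) + C := by
  obtain ⟨C, hC, h⟩ := exists_logSizeSum_map_le T
  refine ⟨2 * k * m, 2 * C, by positivity, by positivity, fun b => ?_⟩
  have h1 := mul_le_mul_of_nonneg_left (logSizeSum_le b) (Nat.cast_nonneg (α := ℝ) k)
  linarith [h b, log_muE_add_one_le (T b)]

lemma log_muE_add_le {m : ℕ} (b c : Fin m → ℚ) : Real.log (muE (b + c) + 1) ≤
    2 * m * (Real.log (muE b + 1) + Real.log (muE c + 1)) := by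
  linarith [log_muE_add_one_le (b + c), logSizeSum_add_le b c, logSizeSum_le b, logSizeSum_le c]

theorem stmt_2 (n d e : ℕ) (U V : Submodule ℚ (Fin n → ℚ)) (hUV : IsCompl U V)
    (ψU : (Fin d → ℚ) ≃ₗ[ℚ] U) (ψV : (Fin e → ℚ) ≃ₗ[ℚ] V) :
    ∃ M C : ℝ, 1 ≤ M ∧ 0 ≤ C ∧ ∀ (u : U) (v : V),
      (Real.log (muE ((u : Fin n → ℚ) + (v : Fin n → ℚ)) + 1) ≤
        M * (Real.log (muE (ψU.symm u) + 1) + Real.log (muE (ψV.symm v) + 1)) + C) ∧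
      (Real.log (muE (ψU.symm u) + 1) + Real.log (muE (ψV.symm v) + 1) ≤
        M * Real.log (muE ((u : Fin n → ℚ) + (v : Fin n → ℚ)) + 1) + C) := by
  obtain ⟨M₁, C₁, hM₁, hC₁, h₁⟩ := exists_log_muE_map_le (U.subtype ∘ₗ ψU.toLinearMap)
  obtain ⟨M₂, C₂, hM₂, hC₂, h₂⟩ := exists_log_muE_map_le (V.subtype ∘ₗ ψV.toLinearMap)
  obtain ⟨M₃, C₃, hM₃, hC₃, h₃⟩ :=
    exists_log_muE_map_le (ψU.symm.toLinearMap ∘ₗ U.projectionOnto V hUV)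
  obtain ⟨M₄, C₄, hM₄, hC₄, h₄⟩ :=
    exists_log_muE_map_le (ψV.symm.toLinearMap ∘ₗ V.projectionOnto U hUV.symm)
  refine ⟨1 + 2 * n * (M₁ + M₂) + (M₃ + M₄), 2 * n * (C₁ + C₂) + (C₃ + C₄),
    le_add_of_le_of_nonneg (le_add_of_nonneg_right (by positivity)) (by positivity),
    by positivity, fun u v => ⟨?_, ?_⟩⟩
  · have hu := h₁ (ψU.symm u)
    have hv := h₂ (ψV.symm v)
    simp only [LinearMap.comp_apply, LinearEquiv.coe_coe, LinearEquiv.apply_symm_apply,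
      Submodule.subtype_apply] at hu hv
    have hx := log_muE_add_one_nonneg (ψU.symm u)
    have hy := log_muE_add_one_nonneg (ψV.symm v)
    generalize Real.log (muE (ψU.symm u) + 1) = x at *
    generalize Real.log (muE (ψV.symm v) + 1) = y at *
    have hn : (0 : ℝ) ≤ 2 * n := by positivity
    have hs := mul_le_mul_of_nonneg_left (add_le_add hu hv) hn
    have hxy : 0 ≤ (1 + M₃ + M₄) * (x + y) := by positivity
    have hcross : 0 ≤ 2 * n * (M₁ * y + M₂ * x) := by positivity
    linarith [log_muE_add_le (u : Fin n → ℚ) v]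
  · have hu := h₃ ((u : Fin n → ℚ) + (v : Fin n → ℚ))
    have hv := h₄ ((u : Fin n → ℚ) + (v : Fin n → ℚ))
    simp only [LinearMap.comp_apply, LinearEquiv.coe_coe, map_add,
      Submodule.projectionOnto_apply_left, Submodule.projectionOnto_apply_right,
      map_zero, add_zero, zero_add] at hu hv
    have hz := log_muE_add_one_nonneg ((u : Fin n → ℚ) + (v : Fin n → ℚ))
    generalize Real.log (muE ((u : Fin n → ℚ) + (v : Fin n → ℚ)) + 1) = z at *
    have hM : 0 ≤ (1 + 2 * n * (M₁ + M₂)) * z := by positivity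
    have hC : 0 ≤ 2 * n * (C₁ + C₂) := by positivity
    linarith
end

section
/- Let x > y ≥ 1 be coprime integers and set λ = x/y ∈ ℚ. Then for every integer m ≥ 1 there exist s ∈ ℕ and integers c₀, c₁, …, c_s with 0 ≤ cᵢ < x for every i, such that m = Σᵢ₌₀ˢ cᵢ·λⁱ (an identity in ℚ) and λˢ ≤ m. -/
theorem stmt_5 (x y : ℤ) (hy : 1 ≤ y) (hxy : y < x) (hcop : IsCoprime x y)
    (lam : ℚ) (hlam : lam = (x : ℚ) / (y : ℚ)) :
    ∀ m : ℤ, 1 ≤ m → ∃ (s : ℕ) (c : ℕ → ℤ),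
      (∀ i ≤ s, 0 ≤ c i ∧ c i < x) ∧
      (m : ℚ) = ∑ i ∈ Finset.range (s + 1), (c i : ℚ) * lam ^ i ∧
      lam ^ s ≤ (m : ℚ) := by
  intro m
  induction h : m.toNat using Nat.strong_induction_on generalizing m with
  | _ n ih =>
  intro hm
  by_cases hmx : m < x
  · refine ⟨0, fun _ => m, fun _ _ => ⟨zero_le_one.trans hm, hmx⟩, by simp, ?_⟩
    simpa using (by exact_mod_cast hm : (1 : ℚ) ≤ m)
  have hx : 0 < x := by omega
  have hq : 1 ≤ m / x := (Int.le_ediv_iff_mul_le hx).2 (by omega)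
  have hdiv := Int.emod_add_mul_ediv m x
  have hr := Int.emod_nonneg m hx.ne'
  have hpos : 1 ≤ y * (m / x) := by nlinarith
  have hlt : y * (m / x) < m := by nlinarith
  obtain ⟨s, c, hc, hsum, hle⟩ := ih _ (by omega) (y * (m / x)) rfl hpos
  have hy' : (0 : ℚ) < y := by exact_mod_cast hy
  have hlam0 : 0 ≤ lam := by rw [hlam]; positivity
  have hmul : ((y * (m / x) : ℤ) : ℚ) * lam = ((x * (m / x) : ℤ) : ℚ) := by
    rw [hlam, Int.cast_mul, Int.cast_mul]
    field_simp
  refine ⟨s + 1, fun | 0 => m % x | i + 1 => c i, ?_, ?_, ?_⟩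
  · rintro (_ | i) hi
    · exact ⟨hr, Int.emod_lt_of_pos m hx⟩
    · exact hc i (by omega)
  · rw [Finset.sum_range_succ']
    simp only [pow_succ, ← mul_assoc, ← Finset.sum_mul, ← hsum, hmul, pow_zero, mul_one]
    exact_mod_cast (by omega : m = x * (m / x) + m % x)
  · calc lam ^ (s + 1) = lam ^ s * lam := pow_succ _ _
      _ ≤ ((y * (m / x) : ℤ) : ℚ) * lam := mul_le_mul_of_nonneg_right hle hlam0
      _ = ((x * (m / x) : ℤ) : ℚ) := hmul
      _ ≤ m := by exact_mod_cast (by omega : x * (m / x) ≤ m)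
end

section
/- Let N, M be nonzero integers and ε > 0 a real number. Then there exist constants C₃, C₄ > 0 (depending only on N, M, ε) such that for every nonzero integer γ and all s, k ∈ ℕ, setting β = γ/(Mˢ·Nᵏ) ∈ ℚ: (i) ln|γ| ≤ C₃·max{s,k} + ln(μ(β)); and (ii) if there exist a prime p and a natural number m with m ≥ ε·max{s,k} and pᵐ dividing |Mˢ·Nᵏ|/gcd(γ, Mˢ·Nᵏ), then max{s,k} + ln|γ| ≤ C₄·ln(μ(β)). -/
theorem den_intCast_div (a b : ℤ) (hb : b ≠ 0) :
    ((a : ℚ) / (b : ℚ)).den = b.natAbs / Int.gcd a b := by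
  rw [← Rat.divInt_eq_div, Rat.den_divInt, if_neg hb, Int.gcd_comm]

theorem natAbs_le_natAbs_mul_num_div (a b : ℤ) (hb : b ≠ 0) :
    a.natAbs ≤ b.natAbs * ((a : ℚ) / (b : ℚ)).num.natAbs := by
  set q : ℚ := (a : ℚ) / (b : ℚ) with hq
  have hbq : (b : ℚ) ≠ 0 := by exact_mod_cast hb
  have h : a * (q.den : ℤ) = b * q.num := by
    have h1 : (a : ℚ) = q * b := by rw [hq, div_mul_cancel₀ _ hbq]
    have h2 : (a : ℚ) * q.den = b * q.num := by
      rw [h1, ← Rat.mul_den_eq_num q]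
      ring
    exact_mod_cast h2
  calc a.natAbs ≤ a.natAbs * q.den := Nat.le_mul_of_pos_right _ q.den_pos
    _ = b.natAbs * q.num.natAbs := by
      rw [← Int.natAbs_mul, ← h, Int.natAbs_mul, Int.natAbs_natCast]

theorem natAbs_num_le_mu (q : ℚ) : (q.num.natAbs : ℝ) ≤ mu q := by
  unfold mu
  exact_mod_cast Nat.le_mul_of_pos_right _ q.den_pos

theorem den_le_mu {q : ℚ} (hq : q ≠ 0) : (q.den : ℝ) ≤ mu q := by
  unfold mu
  exact_mod_cast Nat.le_mul_of_pos_left _ (Int.natAbs_pos.2 (Rat.num_ne_zero.2 hq))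

theorem log_abs_pow_mul_pow_le (M N : ℤ) (hM : M ≠ 0) (hN : N ≠ 0) (s k : ℕ) :
    Real.log |((M ^ s * N ^ k : ℤ) : ℝ)| ≤
      (Real.log |(M : ℝ)| + Real.log |(N : ℝ)|) * (max s k : ℝ) := by
  have hM' : (M : ℝ) ≠ 0 := by exact_mod_cast hM
  have hN' : (N : ℝ) ≠ 0 := by exact_mod_cast hN
  have hlM : 0 ≤ Real.log |(M : ℝ)| := Real.log_nonneg (by exact_mod_cast Int.one_le_abs hM)
  have hlN : 0 ≤ Real.log |(N : ℝ)| := Real.log_nonneg (by exact_mod_cast Int.one_le_abs hN)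
  push_cast
  rw [Real.log_abs, Real.log_mul (pow_ne_zero _ hM') (pow_ne_zero _ hN'), Real.log_pow,
    Real.log_pow, ← Real.log_abs (M : ℝ), ← Real.log_abs (N : ℝ)]
  nlinarith [mul_le_mul_of_nonneg_left (le_max_left (s : ℝ) k) hlM,
    mul_le_mul_of_nonneg_left (le_max_right (s : ℝ) k) hlN]

theorem log_abs_le_log_abs_add_log_mu (a b : ℤ) (ha : a ≠ 0) (hb : b ≠ 0) :
    Real.log |(a : ℝ)| ≤ Real.log |(b : ℝ)| + Real.log (mu ((a : ℚ) / (b : ℚ))) := by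
  have hq : (a : ℚ) / (b : ℚ) ≠ 0 := div_ne_zero (by exact_mod_cast ha) (by exact_mod_cast hb)
  have ha' : 0 < |(a : ℝ)| := abs_pos.2 (by exact_mod_cast ha)
  have hb' : 0 < |(b : ℝ)| := abs_pos.2 (by exact_mod_cast hb)
  have hmu : 0 < mu ((a : ℚ) / (b : ℚ)) :=
    lt_of_lt_of_le (by exact_mod_cast Rat.den_pos _) (den_le_mu hq)
  rw [← Real.log_mul hb'.ne' hmu.ne']
  refine Real.log_le_log ha' ?_
  have h : (a.natAbs : ℝ) ≤ b.natAbs * ((a : ℚ) / (b : ℚ)).num.natAbs := by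
    exact_mod_cast natAbs_le_natAbs_mul_num_div a b hb
  rw [Nat.cast_natAbs a, Nat.cast_natAbs b, Int.cast_abs, Int.cast_abs] at h
  exact h.trans (mul_le_mul_of_nonneg_left (natAbs_num_le_mu _) hb'.le)

theorem mul_log_two_le_log_mu {q : ℚ} (hq : q ≠ 0) {p m : ℕ} (hp : p.Prime)
    (h : p ^ m ∣ q.den) : (m : ℝ) * Real.log 2 ≤ Real.log (mu q) := by
  rw [← Real.log_pow]
  refine Real.log_le_log (by positivity) (le_trans ?_ (den_le_mu hq))
  exact_mod_cast (Nat.pow_le_pow_left hp.two_le m).trans (Nat.le_of_dvd q.den_pos h)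

theorem stmt_16 (N M : ℤ) (hN : N ≠ 0) (hM : M ≠ 0) (ε : ℝ) (hε : 0 < ε) :
    ∃ C₃ C₄ : ℝ, 0 < C₃ ∧ 0 < C₄ ∧
      ∀ (γ : ℤ), γ ≠ 0 → ∀ (s k : ℕ),
        (Real.log |(γ : ℝ)| ≤ C₃ * (max s k : ℝ) +
            Real.log (mu ((γ : ℚ) / ((M : ℚ) ^ s * (N : ℚ) ^ k)))) ∧
        ((∃ (p m : ℕ), p.Prime ∧ ε * (max s k : ℝ) ≤ (m : ℝ) ∧
            p ^ m ∣ (M ^ s * N ^ k).natAbs / Int.gcd γ (M ^ s * N ^ k)) →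
          (max s k : ℝ) + Real.log |(γ : ℝ)| ≤
            C₄ * Real.log (mu ((γ : ℚ) / ((M : ℚ) ^ s * (N : ℚ) ^ k)))) := by
  have hlM : 0 ≤ Real.log |(M : ℝ)| := Real.log_nonneg (by exact_mod_cast Int.one_le_abs hM)
  have hlN : 0 ≤ Real.log |(N : ℝ)| := Real.log_nonneg (by exact_mod_cast Int.one_le_abs hN)
  have hl2 : 0 < Real.log 2 := Real.log_pos one_lt_two
  obtain ⟨C, hC⟩ : ∃ C, C = Real.log |(M : ℝ)| + Real.log |(N : ℝ)| + 1 := ⟨_, rfl⟩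
  have hC0 : 0 < C := by linarith
  refine ⟨C, (1 + C) / (ε * Real.log 2) + 1, hC0, by positivity, fun γ hγ s k => ?_⟩
  have hα : M ^ s * N ^ k ≠ 0 := mul_ne_zero (pow_ne_zero _ hM) (pow_ne_zero _ hN)
  have hcast : (M : ℚ) ^ s * (N : ℚ) ^ k = ((M ^ s * N ^ k : ℤ) : ℚ) := by push_cast; rfl
  have hq : (γ : ℚ) / ((M ^ s * N ^ k : ℤ) : ℚ) ≠ 0 :=
    div_ne_zero (by exact_mod_cast hγ) (by exact_mod_cast hα)
  have hmax : (0 : ℝ) ≤ max (s : ℝ) k := le_max_of_le_left s.cast_nonneg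
  rw [hcast, ← den_intCast_div γ _ hα]
  have hlog : Real.log |(γ : ℝ)| ≤ C * (max s k : ℝ) +
      Real.log (mu ((γ : ℚ) / ((M ^ s * N ^ k : ℤ) : ℚ))) := by
    have h1 := log_abs_le_log_abs_add_log_mu γ _ hγ hα
    have h2 := log_abs_pow_mul_pow_le M N hM hN s k
    rw [hC, add_one_mul]
    linarith
  refine ⟨hlog, ?_⟩
  rintro ⟨p, m, hp, hm, hdvd⟩
  have h3 := mul_log_two_le_log_mu hq hp hdvd
  set L := Real.log (mu ((γ : ℚ) / ((M ^ s * N ^ k : ℤ) : ℚ)))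
  have h4 : max (s : ℝ) k ≤ L / (ε * Real.log 2) := by
    rw [le_div_iff₀ (by positivity)]
    nlinarith [mul_le_mul_of_nonneg_right hm hl2.le]
  calc max (s : ℝ) k + Real.log |(γ : ℝ)| ≤ (1 + C) * max (s : ℝ) k + L := by linarith
    _ ≤ (1 + C) * (L / (ε * Real.log 2)) + L := by gcongr
    _ = ((1 + C) / (ε * Real.log 2) + 1) * L := by ring
end

section
/- Let N and Q be groups, φ : Q → Aut(N) a group homomorphism, and G = N ⋊_φ Q the semidirect product. Let S be a finite generating set of Q and T a finite subset of N such that N is generated as a group by {φ(q)(t) : q ∈ Q, t ∈ T}. Then G is generated by the finite set X consisting of the images of S and T in G, and for every g ∈ G, writing g = (n, q) with n ∈ N and q ∈ Q, one has ‖g‖_X ≤ ‖q‖_S + ‖n‖_X and ‖q‖_S + ‖n‖_X ≤ 3·‖g‖_X, where n is viewed as the element (n, 1) of G. -/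
/-- Word length of `g` with respect to a generating set `X`: the least `m` such that
`g` is a product of `m` elements of `X ∪ X⁻¹`. -/
noncomputable def wordLength {G : Type*} [Group G] (X : Set G) (g : G) : ℕ :=
  sInf {m | ∃ l : List G, (∀ x ∈ l, x ∈ X ∪ X⁻¹) ∧ l.length = m ∧ l.prod = g}

section WordLength

variable {G H : Type*} [Group G] [Group H] {X : Set G} {Y : Set H}

theorem wordLength_prod_le (l : List G) (hl : ∀ x ∈ l, x ∈ X ∪ X⁻¹) :
    wordLength X l.prod ≤ l.length :=
  Nat.sInf_le ⟨l, hl, rfl, rfl⟩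

theorem exists_list_length_eq_wordLength (hX : Subgroup.closure X = ⊤) (g : G) :
    ∃ l : List G, (∀ x ∈ l, x ∈ X ∪ X⁻¹) ∧ l.length = wordLength X g ∧ l.prod = g := by
  have hg : g ∈ Subgroup.closure X := hX ▸ Subgroup.mem_top g
  rw [← Subgroup.mem_toSubmonoid, Subgroup.closure_toSubmonoid] at hg
  obtain ⟨l, hl, hp⟩ := Submonoid.exists_list_of_mem_closure hg
  exact Nat.sInf_mem (s := {m | ∃ l : List G, (∀ x ∈ l, x ∈ X ∪ X⁻¹) ∧ l.length = m ∧ l.prod = g})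
    ⟨l.length, l, hl, rfl, hp⟩

theorem wordLength_one : wordLength X (1 : G) = 0 := by
  simpa using wordLength_prod_le (X := X) [] (by simp)

theorem wordLength_le_one_of_mem {x : G} (hx : x ∈ X ∪ X⁻¹) : wordLength X x ≤ 1 := by
  simpa using wordLength_prod_le [x] (by simpa using hx)

theorem wordLength_mul_le (hX : Subgroup.closure X = ⊤) (g h : G) :
    wordLength X (g * h) ≤ wordLength X g + wordLength X h := by
  obtain ⟨l, hl, hlen, rfl⟩ := exists_list_length_eq_wordLength hX g
  obtain ⟨m, hm, hmlen, rfl⟩ := exists_list_length_eq_wordLength hX h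
  rw [← hlen, ← hmlen, ← List.prod_append, ← List.length_append]
  refine wordLength_prod_le _ fun x hx => ?_
  exact (List.mem_append.1 hx).elim (hl x) (hm x)

theorem wordLength_inv_le (hX : Subgroup.closure X = ⊤) (g : G) :
    wordLength X g⁻¹ ≤ wordLength X g := by
  obtain ⟨l, hl, hlen, rfl⟩ := exists_list_length_eq_wordLength hX g
  rw [← hlen, List.prod_inv_reverse]
  refine (wordLength_prod_le _ fun x hx => ?_).trans_eq (by simp)
  have := hl x⁻¹ (by simpa using hx)
  simpa [or_comm] using this

theorem wordLength_map_le (hX : Subgroup.closure X = ⊤) (hY : Subgroup.closure Y = ⊤)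
    (f : G →* H) (hf : ∀ x ∈ X, f x ∈ Y ∨ f x = 1) (g : G) :
    wordLength Y (f g) ≤ wordLength X g := by
  have generator_le : ∀ x ∈ X, wordLength Y (f x) ≤ 1 := fun x hx => by
    rcases hf x hx with h | h
    · exact wordLength_le_one_of_mem (Or.inl h)
    · simp [h, wordLength_one]
  have letter_le : ∀ x ∈ X ∪ X⁻¹, wordLength Y (f x) ≤ 1 := by
    rintro x (hx | hx)
    · exact generator_le x hx
    · simpa using (wordLength_inv_le hY (f x⁻¹)).trans (generator_le _ hx)
  obtain ⟨l, hl, hlen, rfl⟩ := exists_list_length_eq_wordLength hX g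
  rw [← hlen]
  clear hlen
  induction l with
  | nil => simp [wordLength_one]
  | cons a l ih =>
    have ha := letter_le a (hl a (by simp))
    have hl' := ih fun x hx => hl x (by simp [hx])
    have hmul := wordLength_mul_le hY (f a) (f l.prod)
    rw [List.prod_cons, map_mul, List.length_cons]
    omega

end WordLength

theorem SemidirectProduct.closure_inl_image_union_inr_image {N Q : Type*} [Group N] [Group Q]
    (φ : Q →* MulAut N) {S : Set Q} (hS : Subgroup.closure S = ⊤) {T : Set N}
    (hT : Subgroup.closure {x : N | ∃ (q : Q) (t : N), t ∈ T ∧ x = φ q t} = ⊤) :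
    Subgroup.closure
      ((SemidirectProduct.inl '' T ∪ SemidirectProduct.inr '' S : Set (N ⋊[φ] Q))) = ⊤ := by
  set K := Subgroup.closure
    ((SemidirectProduct.inl '' T ∪ SemidirectProduct.inr '' S : Set (N ⋊[φ] Q))) with hK
  have inr_mem : ∀ q : Q, (SemidirectProduct.inr q : N ⋊[φ] Q) ∈ K := by
    have : Subgroup.closure S ≤ K.comap SemidirectProduct.inr :=
      (Subgroup.closure_le _).2 fun s hs =>
        Subgroup.subset_closure (Or.inr (Set.mem_image_of_mem _ hs))
    exact fun q => this (hS ▸ Subgroup.mem_top q)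
  have inl_mem : ∀ n : N, (SemidirectProduct.inl n : N ⋊[φ] Q) ∈ K := by
    have : Subgroup.closure {x : N | ∃ (q : Q) (t : N), t ∈ T ∧ x = φ q t} ≤
        K.comap SemidirectProduct.inl := by
      refine (Subgroup.closure_le _).2 ?_
      rintro _ ⟨q, t, ht, rfl⟩
      change SemidirectProduct.inl (φ q t) ∈ K
      rw [SemidirectProduct.inl_aut]
      exact K.mul_mem (K.mul_mem (inr_mem q)
        (Subgroup.subset_closure (Or.inl (Set.mem_image_of_mem _ ht)))) (inr_mem q⁻¹)
    exact fun n => this (hT ▸ Subgroup.mem_top n)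
  refine (Subgroup.eq_top_iff' _).2 fun g => ?_
  rw [← SemidirectProduct.inl_left_mul_inr_right g]
  exact K.mul_mem (inl_mem _) (inr_mem _)

theorem stmt_18 (N Q : Type*) [Group N] [Group Q] (φ : Q →* MulAut N)
    (S : Set Q) (hSfin : S.Finite) (hSgen : Subgroup.closure S = ⊤)
    (T : Set N) (hTfin : T.Finite)
    (hTgen : Subgroup.closure {x : N | ∃ (q : Q) (t : N), t ∈ T ∧ x = φ q t} = ⊤)
    (X : Set (SemidirectProduct N Q φ))
    (hX : X = SemidirectProduct.inl '' T ∪ SemidirectProduct.inr '' S) :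
    Subgroup.closure X = ⊤ ∧
    ∀ g : SemidirectProduct N Q φ,
      wordLength X g ≤ wordLength S g.right + wordLength X (SemidirectProduct.inl g.left) ∧
      wordLength S g.right + wordLength X (SemidirectProduct.inl g.left) ≤ 3 * wordLength X g := by
  have hXgen : Subgroup.closure X = ⊤ := by
    rw [hX]
    exact SemidirectProduct.closure_inl_image_union_inr_image φ hSgen hTgen
  refine ⟨hXgen, fun g => ?_⟩
  have inr_le : wordLength X (SemidirectProduct.inr g.right) ≤ wordLength S g.right := by
    refine wordLength_map_le hSgen hXgen SemidirectProduct.inr (fun s hs => Or.inl ?_) _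
    rw [hX]
    exact Or.inr (Set.mem_image_of_mem _ hs)
  have right_le : wordLength S g.right ≤ wordLength X g := by
    refine wordLength_map_le hXgen hSgen SemidirectProduct.rightHom (fun x hx => ?_) g
    rw [hX] at hx
    rcases hx with ⟨t, -, rfl⟩ | ⟨s, hs, rfl⟩
    · exact Or.inr (by simp)
    · exact Or.inl (by simpa using hs)
  have g_le := wordLength_mul_le hXgen (SemidirectProduct.inl g.left)
    (SemidirectProduct.inr g.right)
  rw [SemidirectProduct.inl_left_mul_inr_right] at g_le
  have left_eq : SemidirectProduct.inl g.left = g * (SemidirectProduct.inr g.right)⁻¹ :=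
    eq_mul_inv_of_mul_eq (SemidirectProduct.inl_left_mul_inr_right g)
  have left_le := wordLength_mul_le hXgen g (SemidirectProduct.inr g.right)⁻¹
  rw [← left_eq] at left_le
  have inv_le := wordLength_inv_le hXgen (SemidirectProduct.inr g.right)
  omega
end
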